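/- Let n = 2^m with m ≥ 1, and let N be the number of orbits of the action on F_2^n of the cyclic group generated by the left cyclic shift ρ. Then the number of functions f : F_2^n → F_2 satisfying f(0) = 0, f(1) = 1, and f(ρ(x)) = f(x) ⊕ 1 for every x ∈ F_2^n \ {0, 1} is exactly 2^{N−2}. -/

import Mathlib

/-- Left cyclic shift on `F_2^n`: `(rho x) i = x ((i+1) mod n)`. -/
def rho {n : ℕ} (x : Fin n → ZMod 2) : Fin n → ZMod 2 :=
  fun i => x ⟨(i.val + 1) % n, Nat.mod_lt _ i.pos⟩

theorem rho_iter {n : ℕ} (k : ℕ) (x : Fin n → ZMod 2) (i : Fin n) :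
    rho^[k] x i = x ⟨(i.val + k) % n, Nat.mod_lt _ i.pos⟩ := by
  induction k generalizing x with
  | zero => simp [Nat.mod_eq_of_lt i.isLt]
  | succ k ih =>
    rw [Function.iterate_succ_apply, ih]
    simp only [rho]
    congr 2
    rw [Nat.mod_add_mod, Nat.add_assoc]

theorem rho_iter_n {n : ℕ} (x : Fin n → ZMod 2) : rho^[n] x = x := by
  funext i
  rw [rho_iter]
  simp [Nat.mod_eq_of_lt i.isLt]

theorem rho_fixed {n : ℕ} (x : Fin n → ZMod 2) (h : rho x = x) : x = 0 ∨ x = 1 := by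
  rcases Nat.eq_zero_or_pos n with h0 | h0
  · subst h0
    left
    exact Subsingleton.elim _ _
  have hk : ∀ i : Fin n, x i = x ⟨0, h0⟩ := by
    intro i
    have h1 : rho^[i.val] x = x := Function.iterate_fixed h _
    have h2 := congrFun h1 ⟨0, h0⟩
    rw [rho_iter] at h2
    rw [← h2]
    congr 1
    ext
    simp [Nat.mod_eq_of_lt i.isLt]
  have h01 : ∀ a : ZMod 2, a = 0 ∨ a = 1 := by decide
  rcases h01 (x ⟨0, h0⟩) with h1 | h1
  · left
    funext i
    rw [hk i, h1]; rfl
  · right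
    funext i
    rw [hk i, h1]; rfl

theorem rho_zero {n : ℕ} : rho (0 : Fin n → ZMod 2) = 0 := rfl
theorem rho_one {n : ℕ} : rho (1 : Fin n → ZMod 2) = 1 := rfl

theorem rho_inj {n : ℕ} : Function.Injective (rho (n := n)) := by
  rcases Nat.eq_zero_or_pos n with h0 | h0
  · subst h0
    exact fun _ _ _ => Subsingleton.elim _ _
  intro x y h
  obtain ⟨k, rfl⟩ : ∃ k, n = k + 1 := ⟨n - 1, by omega⟩
  rw [← rho_iter_n x, ← rho_iter_n y, Function.iterate_succ_apply, Function.iterate_succ_apply, h]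

theorem rho_even {m n : ℕ} (hn : n = 2 ^ m) (x : Fin n → ZMod 2) (hx0 : x ≠ 0) (hx1 : x ≠ 1) :
    2 ∣ Function.minimalPeriod rho x := by
  have h : Function.minimalPeriod rho x ∣ 2 ^ m := by
    rw [← hn]
    exact Function.IsPeriodicPt.minimalPeriod_dvd (rho_iter_n x)
  obtain ⟨k, _, hk⟩ := (Nat.dvd_prime_pow Nat.prime_two).1 h
  rcases k with _ | k
  · exfalso
    have : Function.IsFixedPt rho x := Function.minimalPeriod_eq_one_iff_isFixedPt.1 (by simpa using hk)
    rcases rho_fixed x this with h | h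
    · exact hx0 h
    · exact hx1 h
  · rw [hk]; exact Dvd.intro_left _ rfl

theorem rho_par {m n : ℕ} (hn : n = 2 ^ m) (x : Fin n → ZMod 2) (hx0 : x ≠ 0) (hx1 : x ≠ 1)
    (a b : ℕ) (h : rho^[a] x = rho^[b] x) : (a : ZMod 2) = b := by
  rw [ZMod.natCast_eq_natCast_iff]
  have hd := rho_even hn x hx0 hx1
  wlog hab : a ≤ b generalizing a b
  · exact (this b a h.symm (by omega)).symm
  obtain ⟨c, rfl⟩ := Nat.exists_eq_add_of_le hab
  rw [Function.iterate_add_apply] at h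
  have h1 : x = rho^[c] x := rho_inj.iterate a h
  have h2 : Function.minimalPeriod rho x ∣ c :=
    Function.IsPeriodicPt.minimalPeriod_dvd h1.symm
  have h3 : 2 ∣ c := hd.trans h2
  unfold Nat.ModEq
  omega

def orb {n : ℕ} (x : Fin n → ZMod 2) : Finset (Fin n → ZMod 2) :=
  (Finset.range n).image (fun j => rho^[j] x)

theorem mem_orb {n : ℕ} (h0 : 0 < n) (x y : Fin n → ZMod 2) : y ∈ orb x ↔ ∃ j, rho^[j] x = y := by
  simp only [orb, Finset.mem_image, Finset.mem_range]
  constructor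
  · rintro ⟨j, _, h⟩; exact ⟨j, h⟩
  · rintro ⟨j, h⟩
    refine ⟨j % n, Nat.mod_lt _ h0, ?_⟩
    rw [← h]
    exact (Function.IsPeriodicPt.iterate_mod_apply (rho_iter_n x) j)

theorem orb_rho {n : ℕ} (h0 : 0 < n) (x : Fin n → ZMod 2) : orb (rho x) = orb x := by
  ext y
  rw [mem_orb h0, mem_orb h0]
  constructor
  · rintro ⟨j, h⟩; exact ⟨j + 1, h⟩
  · rintro ⟨j, h⟩
    refine ⟨j + (n - 1), ?_⟩
    rw [← Function.iterate_succ_apply, show (j + (n-1)).succ = j + n by omega,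
      Function.iterate_add_apply, rho_iter_n, h]

theorem self_mem_orb {n : ℕ} (h0 : 0 < n) (x : Fin n → ZMod 2) : x ∈ orb x :=
  (mem_orb h0 x x).2 ⟨0, rfl⟩

theorem iter_eq_zero {n : ℕ} (j : ℕ) (x : Fin n → ZMod 2) : rho^[j] x = 0 ↔ x = 0 := by
  have : rho^[j] (0 : Fin n → ZMod 2) = 0 := Function.iterate_fixed rho_zero j
  constructor
  · intro h; exact rho_inj.iterate j (h.trans this.symm)
  · rintro rfl; exact this

theorem iter_eq_one {n : ℕ} (j : ℕ) (x : Fin n → ZMod 2) : rho^[j] x = 1 ↔ x = 1 := by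
  have : rho^[j] (1 : Fin n → ZMod 2) = 1 := Function.iterate_fixed rho_one j
  constructor
  · intro h; exact rho_inj.iterate j (h.trans this.symm)
  · rintro rfl; exact this

theorem orb_eq_zero {n : ℕ} (h0 : 0 < n) (x : Fin n → ZMod 2) (h : orb x = orb 0) : x = 0 := by
  have := self_mem_orb h0 0
  rw [← h, mem_orb h0] at this
  obtain ⟨j, hj⟩ := this
  exact (iter_eq_zero j x).1 hj

theorem orb_eq_one {n : ℕ} (h0 : 0 < n) (x : Fin n → ZMod 2) (h : orb x = orb 1) : x = 1 := by
  have := self_mem_orb h0 1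
  rw [← h, mem_orb h0] at this
  obtain ⟨j, hj⟩ := this
  exact (iter_eq_one j x).1 hj

theorem stmt_5 (m : ℕ) (hm : 1 ≤ m) (n : ℕ) (hn : n = 2 ^ m)
    (N : ℕ)
    (hN : N = (Finset.univ.image
      (fun x : Fin n → ZMod 2 =>
        (Finset.range n).image (fun j => rho^[j] x))).card) :
    (Finset.univ.filter (fun f : (Fin n → ZMod 2) → ZMod 2 =>
        f 0 = 0 ∧ f 1 = 1 ∧
          ∀ x : Fin n → ZMod 2, x ≠ 0 → x ≠ 1 → f (rho x) = f x + 1)).card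
      = 2 ^ (N - 2) := by
  classical
  have h0 : 0 < n := by rw [hn]; positivity
  have h10 : (1 : Fin n → ZMod 2) ≠ 0 := by
    intro h
    have := congrFun h ⟨0, h0⟩
    simp at this
  change N = (Finset.univ.image (orb (n := n))).card at hN
  let S : Finset (Finset (Fin n → ZMod 2)) := Finset.univ.image (orb (n := n)) \ {orb 0, orb 1}
  have hS : S.card = N - 2 := by
    have hsub : ({orb 0, orb 1} : Finset (Finset (Fin n → ZMod 2))) ⊆
        Finset.univ.image (orb (n := n)) := by
      intro s hs
      simp only [Finset.mem_insert, Finset.mem_singleton] at hs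
      rcases hs with rfl | rfl <;> simp
    rw [Finset.card_sdiff_of_subset hsub, ← hN, Finset.card_pair]
    intro h
    exact h10 (orb_eq_zero h0 _ h.symm)
  have hmemS : ∀ x : Fin n → ZMod 2, x ≠ 0 → x ≠ 1 → orb x ∈ S := by
    intro x hx0 hx1
    simp only [S, Finset.mem_sdiff, Finset.mem_image, Finset.mem_univ, true_and,
      Finset.mem_insert, Finset.mem_singleton, not_or]
    exact ⟨⟨x, rfl⟩, fun h => hx0 (orb_eq_zero h0 _ h), fun h => hx1 (orb_eq_one h0 _ h)⟩
  have hrep : ∀ s : S, ∃ x : Fin n → ZMod 2, orb x = s.1 ∧ x ≠ 0 ∧ x ≠ 1 := by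
    rintro ⟨s, hs⟩
    simp only [S, Finset.mem_sdiff, Finset.mem_image, Finset.mem_univ, true_and,
      Finset.mem_insert, Finset.mem_singleton, not_or] at hs
    obtain ⟨⟨x, rfl⟩, ha, hb⟩ := hs
    exact ⟨x, rfl, fun h => ha (by rw [h]), fun h => hb (by rw [h])⟩
  choose rep hrep1 hrep2 hrep3 using hrep
  have hk : ∀ (s : S) (x : Fin n → ZMod 2), ∃ k : ℕ, orb x = s.1 → rho^[k] (rep s) = x := by
    intro s x
    by_cases h : orb x = s.1
    · have := self_mem_orb h0 x
      rw [h, ← hrep1 s, mem_orb h0] at this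
      obtain ⟨k, hk⟩ := this
      exact ⟨k, fun _ => hk⟩
    · exact ⟨0, fun h' => absurd h' h⟩
  choose k hk using hk
  have hcard : Fintype.card (S → ZMod 2) = 2 ^ (N - 2) := by
    rw [Fintype.card_fun, ZMod.card, Fintype.card_coe, hS]
  rw [← hcard, ← Finset.card_univ]
  refine Finset.card_bij (fun f _ s => f (rep s)) (fun _ _ => Finset.mem_univ _) ?_ ?_
  · intro f hf g hg hfg
    have key : ∀ f : (Fin n → ZMod 2) → ZMod 2,
        (∀ x : Fin n → ZMod 2, x ≠ 0 → x ≠ 1 → f (rho x) = f x + 1) →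
        ∀ x : Fin n → ZMod 2, x ≠ 0 → x ≠ 1 → ∀ j : ℕ, f (rho^[j] x) = f x + j := by
      intro f hf x hx0 hx1 j
      induction j with
      | zero => simp
      | succ j ih =>
        rw [Function.iterate_succ_apply', hf _ (by rwa [Ne, iter_eq_zero]) (by rwa [Ne, iter_eq_one]), ih]
        push_cast
        ring
    simp only [Finset.mem_filter, Finset.mem_univ, true_and] at hf hg
    funext x
    by_cases hx0 : x = 0
    · rw [hx0, hf.1, hg.1]
    by_cases hx1 : x = 1
    · rw [hx1, hf.2.1, hg.2.1]
    let s : S := ⟨orb x, hmemS x hx0 hx1⟩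
    have hx := hk s x rfl
    rw [← hx, key f hf.2.2 _ (hrep2 s) (hrep3 s), key g hg.2.2 _ (hrep2 s) (hrep3 s)]
    have := congrFun hfg s
    rw [this]
  · intro g _
    let f : (Fin n → ZMod 2) → ZMod 2 := fun x =>
      if hx0 : x = 0 then 0 else if hx1 : x = 1 then 1 else
        g ⟨orb x, hmemS x hx0 hx1⟩ + (k ⟨orb x, hmemS x hx0 hx1⟩ x : ZMod 2)
    have hfs : ∀ (s : S) (x : Fin n → ZMod 2), x ≠ 0 → x ≠ 1 → orb x = s.1 →
        f x = g s + (k s x : ZMod 2) := by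
      rintro ⟨s, hs⟩ x hx0 hx1 h
      simp only at h
      subst h
      simp only [f, dif_neg hx0, dif_neg hx1]
    refine ⟨f, ?_, ?_⟩
    · simp only [Finset.mem_filter, Finset.mem_univ, true_and]
      refine ⟨by simp [f], by simp [f, h10], ?_⟩
      intro x hx0 hx1
      let s : S := ⟨orb x, hmemS x hx0 hx1⟩
      have e1 : orb (rho x) = s.1 := orb_rho h0 x
      rw [hfs s x hx0 hx1 rfl, hfs s (rho x) (by rwa [Ne, ← Function.iterate_one rho, iter_eq_zero])
        (by rwa [Ne, ← Function.iterate_one rho, iter_eq_one]) e1]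
      have := rho_par hn (rep s) (hrep2 s) (hrep3 s) (k s (rho x)) (k s x + 1)
        (by rw [hk s _ e1, Function.iterate_succ_apply', hk s x rfl])
      rw [this]
      push_cast
      ring
    · funext s
      rw [hfs s _ (hrep2 s) (hrep3 s) (hrep1 s)]
      have := rho_par hn (rep s) (hrep2 s) (hrep3 s) (k s (rep s)) 0
        (by rw [hk s _ (hrep1 s)]; rfl)
      rw [this]
      simp
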